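/- There exist origin-symmetric convex bodies K₀ and E₀ in R^2, each containing the origin in its interior, such that σ({θ ∈ S^1 : ρ_{K₀}(θ) ≥ t}) = σ({θ ∈ S^1 : ρ_{E₀}(θ) ≥ t}) for all t ≥ 0, but σ({θ ∈ S^1 : h_{K₀}(θ) ≥ t₀}) ≠ σ({θ ∈ S^1 : h_{E₀}(θ) ≥ t₀}) for some t₀ ≥ 0; in particular the polar bodies satisfy |K₀°| ≠ |E₀°|. -/

import Mathlib

open MeasureTheory Metric Set
open scoped RealInnerProductSpace ENNReal NNReal

noncomputable section

/-- Euclidean space `ℝ^n`. -/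
abbrev Euc (n : ℕ) := EuclideanSpace ℝ (Fin n)

/-- A convex body: a compact convex set with nonempty interior. -/
def IsConvexBody {n : ℕ} (K : Set (Euc n)) : Prop :=
  Convex ℝ K ∧ IsCompact K ∧ (interior K).Nonempty

/-- The Haar (rotation invariant) probability measure of a set of directions on the
unit sphere `S^{n-1}`, realized as normalized `(n-1)`-dimensional Hausdorff measure. -/
def sphHaar (n : ℕ) (A : Set (Euc n)) : ℝ≥0∞ :=
  μH[(n : ℝ) - 1] (A ∩ sphere (0 : Euc n) 1) / μH[(n : ℝ) - 1] (sphere (0 : Euc n) 1)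

/-- `|K ∩ θ^⊥|`: the `(n-1)`-dimensional Hausdorff measure of the central section of `K`
perpendicular to `θ`. -/
def sectionVol (n : ℕ) (K : Set (Euc n)) (θ : Euc n) : ℝ≥0∞ :=
  μH[(n : ℝ) - 1] (K ∩ {x : Euc n | ⟪x, θ⟫ = 0})

/-- `S_K(t)`: distribution function of the areas of central hyperplane sections. -/
def Sdist (n : ℕ) (K : Set (Euc n)) (t : ℝ) : ℝ≥0∞ :=
  sphHaar n {θ : Euc n | ENNReal.ofReal t ≤ sectionVol n K θ}

/-- `|K | θ^⊥|`: the `(n-1)`-dimensional Hausdorff measure of the orthogonal projection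
of `K` onto the hyperplane `θ^⊥` (for a unit vector `θ`). -/
def projVol (n : ℕ) (K : Set (Euc n)) (θ : Euc n) : ℝ≥0∞ :=
  μH[(n : ℝ) - 1] ((fun x => x - ⟪x, θ⟫ • θ) '' K)

/-- `Π_K(t)`: distribution function of the volumes of hyperplane projections. -/
def PiDist (n : ℕ) (K : Set (Euc n)) (t : ℝ) : ℝ≥0∞ :=
  sphHaar n {θ : Euc n | ENNReal.ofReal t ≤ projVol n K θ}

/-- The radial function `ρ_K(θ) = max {a ≥ 0 : a • θ ∈ K}`. -/
def radial {n : ℕ} (K : Set (Euc n)) (θ : Euc n) : ℝ :=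
  sSup {a : ℝ | 0 ≤ a ∧ a • θ ∈ K}

/-- The support function `h_K(θ) = sup_{y ∈ K} ⟨θ, y⟩`. -/
def suppFn {n : ℕ} (K : Set (Euc n)) (θ : Euc n) : ℝ :=
  sSup ((fun y => ⟪θ, y⟫) '' K)

/-- The polar body `K° = {x : ⟨x, y⟩ ≤ 1 for all y ∈ K}`. -/
def polarBody {n : ℕ} (K : Set (Euc n)) : Set (Euc n) :=
  {x | ∀ y ∈ K, ⟪x, y⟫ ≤ 1}

instance : MeasurableSpace Circle := borel Circle

instance : BorelSpace Circle := ⟨rfl⟩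

instance : IsIsometricSMul Circle Circle where
  isometry_smul c := Isometry.of_dist_eq fun a b => by
    change dist ((c * a : Circle) : ℂ) ((c * b : Circle) : ℂ) = dist (a : ℂ) (b : ℂ)
    rw [dist_eq_norm, dist_eq_norm, Circle.coe_mul, Circle.coe_mul, ← mul_sub, norm_mul,
      Circle.norm_coe, one_mul]

/-- The inclusion of the unit circle of `ℂ` into the Euclidean plane. -/
def circleToEuc (z : Circle) : Euc 2 := Complex.orthonormalBasisOneI.repr (z : ℂ)

@[simp]
theorem circleToEuc_zero (z : Circle) : circleToEuc z 0 = (z : ℂ).re := by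
  simp [circleToEuc, Complex.orthonormalBasisOneI_repr_apply]

@[simp]
theorem circleToEuc_one (z : Circle) : circleToEuc z 1 = (z : ℂ).im := by
  simp [circleToEuc, Complex.orthonormalBasisOneI_repr_apply]

@[simp]
theorem norm_circleToEuc (z : Circle) : ‖circleToEuc z‖ = 1 := by
  simp [circleToEuc, Circle.norm_coe]

theorem isometry_circleToEuc : Isometry circleToEuc :=
  Complex.orthonormalBasisOneI.repr.isometry.comp isometry_subtype_coe

theorem range_circleToEuc : range circleToEuc = sphere (0 : Euc 2) 1 := by
  ext v
  constructor
  · rintro ⟨z, rfl⟩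
    simp
  · intro hv
    have hz : ‖Complex.orthonormalBasisOneI.repr.symm v‖ = 1 := by
      rw [LinearIsometryEquiv.norm_map]
      exact mem_sphere_zero_iff_norm.1 hv
    exact ⟨⟨_, mem_sphere_zero_iff_norm.2 hz⟩, LinearIsometryEquiv.apply_symm_apply _ v⟩

theorem sphHaar_two (A : Set (Euc 2)) :
    sphHaar 2 A = (μH[1] : Measure Circle) (circleToEuc ⁻¹' A) / μH[1] (univ : Set Circle) := by
  have h : ((2 : ℕ) : ℝ) - 1 = 1 := by norm_num
  have key (S : Set (Euc 2)) :
      (μH[1] : Measure (Euc 2)) (S ∩ sphere 0 1) = μH[1] (circleToEuc ⁻¹' S) := by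
    rw [isometry_circleToEuc.hausdorffMeasure_preimage (.inl zero_le_one), range_circleToEuc]
  rw [sphHaar, h, key, ← preimage_univ (f := circleToEuc), ← key univ, univ_inter]

instance : Measure.IsHaarMeasure (μH[1] : Measure Circle) := by
  refine Measure.isHaarMeasure_of_isCompact_nonempty_interior _ univ isCompact_univ
    (by simp) ?_ ?_
  · intro h0
    have hlip : LipschitzWith 1 fun z : Circle => (z : ℂ).re :=
      LipschitzWith.of_dist_le_mul fun a b => by
        rw [NNReal.coe_one, one_mul, Real.dist_eq, ← Complex.sub_re]
        exact Complex.abs_re_le_norm _ |>.trans_eq (dist_eq_norm _ _).symm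
    have h1 := hlip.hausdorffMeasure_image_le zero_le_one univ
    rw [h0, mul_zero, hausdorffMeasure_real] at h1
    have h2 : Icc (-1 : ℝ) 1 ⊆ (fun z : Circle => (z : ℂ).re) '' univ := by
      intro x hx
      exact ⟨Circle.exp (Real.arccos x), mem_univ _, by
        simp [Circle.coe_exp, Complex.exp_ofReal_mul_I_re, Real.cos_arccos hx.1 hx.2]⟩
    have h3 := (measure_mono h2).trans h1
    norm_num at h3
  · have hlip : LipschitzWith 1 Circle.exp := by
      refine LipschitzWith.of_dist_le_mul fun a b => ?_
      rw [NNReal.coe_one, one_mul, Real.dist_eq]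
      change dist (Circle.exp a : ℂ) (Circle.exp b : ℂ) ≤ _
      rw [dist_eq_norm, Circle.coe_exp, Circle.coe_exp]
      have h := Real.norm_exp_I_mul_ofReal_sub_one_le (x := a - b)
      have e : Complex.exp (a * Complex.I) - Complex.exp (b * Complex.I) =
          Complex.exp (b * Complex.I) * (Complex.exp (Complex.I * ((a - b : ℝ) : ℂ)) - 1) := by
        rw [mul_sub, ← Complex.exp_add, mul_one]
        congr 2
        push_cast
        ring
      rw [e, norm_mul, Complex.norm_exp_ofReal_mul_I, one_mul]
      simpa using h
    have h1 := hlip.hausdorffMeasure_image_le zero_le_one (Icc (-Real.pi) Real.pi)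
    have h2 : (univ : Set Circle) ⊆ Circle.exp '' Icc (-Real.pi) Real.pi := fun z _ =>
      ⟨Complex.arg z, ⟨(Complex.neg_pi_lt_arg _).le, Complex.arg_le_pi _⟩, Circle.exp_arg z⟩
    refine ne_top_of_le_ne_top ?_ ((measure_mono h2).trans h1)
    rw [hausdorffMeasure_real, Real.volume_Icc]
    simp

theorem measurePreserving_circle_sq :
    MeasurePreserving (fun z : Circle => z ^ 2) μH[1] μH[1] :=
  (powMonoidHom 2 : Circle →* Circle).measurePreserving (continuous_pow 2)
    (fun z => ⟨Circle.exp (Complex.arg z / 2), by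
      rw [powMonoidHom_apply, ← Circle.exp_natCast_mul]
      convert Circle.exp_arg z using 2
      push_cast
      ring⟩) rfl

/-- The squaring map preserves the normalized measure on the circle. -/
theorem sphHaar_congr_sq {A B : Set (Euc 2)} (hA : MeasurableSet (circleToEuc ⁻¹' A))
    (h : ∀ z : Circle, circleToEuc z ∈ B ↔ circleToEuc (z ^ 2) ∈ A) :
    sphHaar 2 B = sphHaar 2 A := by
  have e : circleToEuc ⁻¹' B = (fun z : Circle => z ^ 2) ⁻¹' (circleToEuc ⁻¹' A) :=
    Set.ext fun z => h z
  rw [sphHaar_two, sphHaar_two, e,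
    measurePreserving_circle_sq.measure_preimage hA.nullMeasurableSet]

/-- A set of directions is strictly larger in measure than a subset if it contains a
nonempty open set of further directions. -/
theorem sphHaar_lt_of_isOpen {A B U : Set (Euc 2)} (hU : IsOpen U) (hAB : A ⊆ B)
    (hUB : ∀ z : Circle, circleToEuc z ∈ U → circleToEuc z ∈ B \ A)
    (hne : ∃ z : Circle, circleToEuc z ∈ U) : sphHaar 2 A < sphHaar 2 B := by
  have hUo : IsOpen (circleToEuc ⁻¹' U) := hU.preimage isometry_circleToEuc.continuous
  have hpos := hUo.measure_pos (μH[1] : Measure Circle) hne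
  rw [sphHaar_two, sphHaar_two]
  refine ENNReal.div_lt_div_right (NeZero.ne _) (measure_ne_top _ _) ?_
  calc (μH[1] : Measure Circle) (circleToEuc ⁻¹' A)
      < μH[1] (circleToEuc ⁻¹' A) + μH[1] (circleToEuc ⁻¹' U) :=
        ENNReal.lt_add_right (measure_ne_top _ _) hpos.ne'
    _ = μH[1] (circleToEuc ⁻¹' A ∪ circleToEuc ⁻¹' U) :=
        (measure_union (disjoint_left.2 fun z hz hz' => (hUB z hz').2 hz)
          hUo.measurableSet).symm
    _ ≤ μH[1] (circleToEuc ⁻¹' B) :=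
        measure_mono (union_subset (preimage_mono hAB) fun z hz => (hUB z hz).1)

theorem Euc.norm_sq_two (v : Euc 2) : ‖v‖ ^ 2 = v 0 ^ 2 + v 1 ^ 2 := by
  rw [EuclideanSpace.real_norm_sq_eq, Fin.sum_univ_two]

theorem Euc.inner_two (v w : Euc 2) : ⟪v, w⟫ = v 0 * w 0 + v 1 * w 1 := by
  simp [PiLp.inner_apply, mul_comm]

theorem Euc.abs_one_le_norm (v : Euc 2) : |v 1| ≤ ‖v‖ :=
  PiLp.norm_apply_le v 1

/-- The body bounded by the sinusoidal spirals `r² (1 + |sin φ|) = 2`. -/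
def spiralBody : Set (Euc 2) := {v | ‖v‖ ^ 2 + ‖v‖ * |v 1| ≤ 2}

/-- The square `|x| + |y| ≤ √2`, bounded by `r² (1 + |sin 2φ|) = 2`. -/
def squareBody : Set (Euc 2) := {v | ‖v‖ ^ 2 + 2 * |v 0 * v 1| ≤ 2}

theorem mem_squareBody_iff (v : Euc 2) : v ∈ squareBody ↔ |v 0| + |v 1| ≤ √2 := by
  rw [Real.le_sqrt (by positivity) (by norm_num), squareBody, mem_ofPred_eq, Euc.norm_sq_two,
    abs_mul, add_sq, sq_abs, sq_abs]
  constructor <;> intro h <;> linarith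

theorem mem_spiralBody_iff (v : Euc 2) :
    v ∈ spiralBody ↔ ∃ s : ℝ, 0 < s ∧ s ^ 2 + v 0 ^ 2 / 4 ≤ 1 ∧ |v 1| + s⁻¹ ≤ 2 * s := by
  have hr := norm_nonneg v
  have hr2 := Euc.norm_sq_two v
  rw [spiralBody, mem_ofPred_eq]
  constructor
  · intro h
    have hq : √(v 1 ^ 2 + 8) ^ 2 = v 1 ^ 2 + 8 := Real.sq_sqrt (by positivity)
    have hq0 : 0 < √(v 1 ^ 2 + 8) := Real.sqrt_pos.2 (by positivity)
    obtain ⟨s, hs⟩ : ∃ s, s = (|v 1| + √(v 1 ^ 2 + 8)) / 4 := ⟨_, rfl⟩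
    have hs0 : 0 < s := by rw [hs]; positivity
    have hsq : 2 * s ^ 2 - |v 1| * s = 1 := by
      rw [hs]
      nlinarith [sq_abs (v 1)]
    have hinv : s⁻¹ = 2 * s - |v 1| := by
      field_simp
      linarith
    have hle : ‖v‖ ≤ s⁻¹ := by
      by_contra! hlt
      have h0 : 0 < s⁻¹ := inv_pos.2 hs0
      have h1 : s⁻¹ ^ 2 + s⁻¹ * |v 1| = 2 := by
        rw [hinv]
        nlinarith
      nlinarith [abs_nonneg (v 1)]
    refine ⟨s, hs0, ?_, by rw [hinv]; linarith⟩
    have h2 : ‖v‖ ^ 2 ≤ s⁻¹ ^ 2 := by gcongr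
    rw [hinv, hr2] at h2
    nlinarith [sq_abs (v 1)]
  · rintro ⟨s, hs0, h1, h2⟩
    have h0 : 0 < s⁻¹ := inv_pos.2 hs0
    have hss : s * s⁻¹ = 1 := mul_inv_cancel₀ hs0.ne'
    have hsq : ‖v‖ ^ 2 ≤ s⁻¹ ^ 2 := by
      have h3 : |v 1| ^ 2 ≤ (2 * s - s⁻¹) ^ 2 := by
        gcongr
        linarith
      rw [sq_abs] at h3
      nlinarith
    have hle : ‖v‖ ≤ s⁻¹ := by
      rwa [sq_le_sq₀ hr h0.le] at hsq
    have h4 : ‖v‖ * |v 1| ≤ s⁻¹ * (2 * s - s⁻¹) := by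
      gcongr
      linarith
    nlinarith

theorem convex_squareBody : Convex ℝ squareBody := by
  intro v hv w hw a b ha hb hab
  rw [mem_squareBody_iff] at *
  simp only [PiLp.add_apply, PiLp.smul_apply, smul_eq_mul]
  have h (i : Fin 2) : |a * v i + b * w i| ≤ a * |v i| + b * |w i| := by
    refine (abs_add_le _ _).trans_eq ?_
    rw [abs_mul, abs_mul, abs_of_nonneg ha, abs_of_nonneg hb]
  calc |a * v 0 + b * w 0| + |a * v 1 + b * w 1|
      ≤ a * (|v 0| + |v 1|) + b * (|w 0| + |w 1|) := by linarith [h 0, h 1]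
    _ ≤ a * √2 + b * √2 := by gcongr
    _ = √2 := by rw [← add_mul, hab, one_mul]

theorem convex_spiralBody : Convex ℝ spiralBody := by
  intro v hv w hw a b ha hb hab
  rw [mem_spiralBody_iff] at *
  obtain ⟨s, hs, hs1, hs2⟩ := hv
  obtain ⟨t, ht, ht1, ht2⟩ := hw
  simp only [PiLp.add_apply, PiLp.smul_apply, smul_eq_mul]
  have hsq (x y : ℝ) : (a * x + b * y) ^ 2 ≤ a * x ^ 2 + b * y ^ 2 := by
    simpa using (even_two.convexOn_pow (𝕜 := ℝ)).2 (mem_univ x) (mem_univ y) ha hb hab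
  have hinv : (a * s + b * t)⁻¹ ≤ a * s⁻¹ + b * t⁻¹ := by
    simpa using (convexOn_zpow (𝕜 := ℝ) (-1)).2 hs ht ha hb hab
  have hab1 : |a * v 1 + b * w 1| ≤ a * |v 1| + b * |w 1| := by
    refine (abs_add_le _ _).trans_eq ?_
    rw [abs_mul, abs_mul, abs_of_nonneg ha, abs_of_nonneg hb]
  refine ⟨a * s + b * t, ?_, ?_, ?_⟩
  · exact convex_Ioi (0 : ℝ) hs ht ha hb hab
  · nlinarith [hsq s t, hsq (v 0) (w 0), mul_le_mul_of_nonneg_left hs1 ha,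
      mul_le_mul_of_nonneg_left ht1 hb]
  · nlinarith [mul_le_mul_of_nonneg_left hs2 ha, mul_le_mul_of_nonneg_left ht2 hb]

theorem isCompact_of_isClosed_of_norm_sq_le {S : Set (Euc 2)} (hS : IsClosed S)
    (h : ∀ v ∈ S, ‖v‖ ^ 2 ≤ 2) : IsCompact S :=
  (isCompact_closedBall (0 : Euc 2) 2).of_isClosed_subset hS fun v hv => by
    rw [mem_closedBall_zero_iff]
    nlinarith [h v hv, norm_nonneg v]

theorem isCompact_squareBody : IsCompact squareBody := by
  refine isCompact_of_isClosed_of_norm_sq_le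
    (isClosed_le (by fun_prop) continuous_const) fun v hv => ?_
  have h : ‖v‖ ^ 2 + 2 * |v 0 * v 1| ≤ 2 := hv
  linarith [abs_nonneg (v 0 * v 1)]

theorem isCompact_spiralBody : IsCompact spiralBody := by
  refine isCompact_of_isClosed_of_norm_sq_le
    (isClosed_le (by fun_prop) continuous_const) fun v hv => ?_
  have h : ‖v‖ ^ 2 + ‖v‖ * |v 1| ≤ 2 := hv
  nlinarith [abs_nonneg (v 1), norm_nonneg v]

theorem ball_subset_squareBody : ball (0 : Euc 2) 1 ⊆ squareBody := by
  intro v hv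
  rw [mem_ball_zero_iff] at hv
  change ‖v‖ ^ 2 + 2 * |v 0 * v 1| ≤ 2
  rw [abs_mul]
  nlinarith [Euc.norm_sq_two v, norm_nonneg v, sq_abs (v 0), sq_abs (v 1),
    sq_nonneg (|v 0| - |v 1|)]

theorem ball_subset_spiralBody : ball (0 : Euc 2) 1 ⊆ spiralBody := by
  intro v hv
  rw [mem_ball_zero_iff] at hv
  change ‖v‖ ^ 2 + ‖v‖ * |v 1| ≤ 2
  nlinarith [Euc.abs_one_le_norm v, norm_nonneg v]

theorem zero_mem_interior_of_ball_subset {S : Set (Euc 2)} (h : ball (0 : Euc 2) 1 ⊆ S) :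
    (0 : Euc 2) ∈ interior S :=
  mem_interior_iff_mem_nhds.2 (Filter.mem_of_superset (ball_mem_nhds _ one_pos) h)

theorem squareBody_eq_neg : squareBody = -squareBody := by
  ext v
  simp [squareBody]

theorem spiralBody_eq_neg : spiralBody = -spiralBody := by
  ext v
  simp [spiralBody]

theorem radial_spiralBody (z : Circle) :
    radial spiralBody (circleToEuc z) = √(2 / (1 + |(z : ℂ).im|)) := by
  have h : {a : ℝ | 0 ≤ a ∧ a • circleToEuc z ∈ spiralBody} =
      Icc 0 √(2 / (1 + |(z : ℂ).im|)) := by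
    ext a
    refine and_congr_right fun ha => ?_
    rw [Real.le_sqrt ha (by positivity), le_div_iff₀ (by positivity), spiralBody, mem_ofPred_eq,
      norm_smul, norm_circleToEuc, PiLp.smul_apply, circleToEuc_one, smul_eq_mul, abs_mul,
      Real.norm_of_nonneg ha, abs_of_nonneg ha]
    ring_nf
  rw [radial, h, csSup_Icc (Real.sqrt_nonneg _)]

theorem radial_squareBody (z : Circle) :
    radial squareBody (circleToEuc z) = √(2 / (1 + 2 * |(z : ℂ).re * (z : ℂ).im|)) := by
  have h : {a : ℝ | 0 ≤ a ∧ a • circleToEuc z ∈ squareBody} =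
      Icc 0 √(2 / (1 + 2 * |(z : ℂ).re * (z : ℂ).im|)) := by
    ext a
    refine and_congr_right fun ha => ?_
    rw [Real.le_sqrt ha (by positivity), le_div_iff₀ (by positivity), squareBody, mem_ofPred_eq,
      norm_smul, norm_circleToEuc, PiLp.smul_apply, PiLp.smul_apply, circleToEuc_one,
      circleToEuc_zero, smul_eq_mul, smul_eq_mul, abs_mul, abs_mul, abs_mul, abs_mul,
      Real.norm_of_nonneg ha, abs_of_nonneg ha]
    ring_nf
  rw [radial, h, csSup_Icc (Real.sqrt_nonneg _)]

theorem radial_squareBody_eq (z : Circle) :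
    radial squareBody (circleToEuc z) = radial spiralBody (circleToEuc (z ^ 2)) := by
  have h : ((z ^ 2 : Circle) : ℂ).im = 2 * ((z : ℂ).re * (z : ℂ).im) := by
    rw [Circle.coe_pow, sq, Complex.mul_im]
    ring
  rw [radial_spiralBody, radial_squareBody, h, abs_mul (2 : ℝ), abs_two]

theorem sphHaar_le_radial_eq (t : ℝ) :
    sphHaar 2 {θ : Euc 2 | t ≤ radial spiralBody θ} =
      sphHaar 2 {θ : Euc 2 | t ≤ radial squareBody θ} := by
  refine (sphHaar_congr_sq ?_ fun z => ?_).symm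
  · have h : Continuous fun z : Circle => √(2 / (1 + |(z : ℂ).im|)) :=
      Real.continuous_sqrt.comp (continuous_const.div
        (continuous_const.add (Complex.continuous_im.comp continuous_subtype_val).abs)
        fun z => by positivity)
    simp only [preimage_ofPred_eq, radial_spiralBody]
    exact (isClosed_le continuous_const h).measurableSet
  · simp only [mem_ofPred_eq, radial_squareBody_eq]

theorem le_of_mem_spiralBody {v : Euc 2} (hv : v ∈ spiralBody) :
    v 0 ^ 2 + 2 * v 1 ^ 2 ≤ 2 := by
  have h : ‖v‖ ^ 2 + ‖v‖ * |v 1| ≤ 2 := hv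
  nlinarith [Euc.abs_one_le_norm v, Euc.norm_sq_two v, sq_abs (v 1), abs_nonneg (v 1)]

/-- The body lies inside the ellipse `x² / 2 + y² ≤ 1`, whose support function bounds that of
the body. -/
theorem inner_sq_le_of_mem_spiralBody (p : Euc 2) {v : Euc 2} (hv : v ∈ spiralBody) :
    ⟪p, v⟫ ^ 2 ≤ 2 * p 0 ^ 2 + p 1 ^ 2 := by
  have h := le_of_mem_spiralBody hv
  rw [Euc.inner_two]
  nlinarith [sq_nonneg (2 * p 0 * v 1 - p 1 * v 0), sq_nonneg (p 0), sq_nonneg (p 1),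
    mul_le_mul_of_nonneg_left h (sq_nonneg (p 0)), mul_le_mul_of_nonneg_left h (sq_nonneg (p 1))]

theorem suppFn_spiralBody_le (p : Euc 2) : suppFn spiralBody p ≤ √(2 * p 0 ^ 2 + p 1 ^ 2) := by
  refine Real.sSup_le ?_ (Real.sqrt_nonneg _)
  rintro _ ⟨v, hv, rfl⟩
  exact Real.le_sqrt_of_sq_le (inner_sq_le_of_mem_spiralBody p hv)

theorem inner_le_suppFn {n : ℕ} {S : Set (Euc n)} (hS : IsCompact S) (p : Euc n) {v : Euc n}
    (hv : v ∈ S) : ⟪p, v⟫ ≤ suppFn S p :=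
  le_csSup (hS.image (by fun_prop)).bddAbove (mem_image_of_mem _ hv)

theorem axis_mem_squareBody (i : Fin 2) (ε : ℝ) (hε : |ε| = 1) :
    EuclideanSpace.single i (ε * √2) ∈ squareBody := by
  rw [mem_squareBody_iff]
  fin_cases i <;> simp [abs_mul, hε, abs_of_nonneg]

theorem le_suppFn_squareBody (p : Euc 2) (i : Fin 2) : √2 * |p i| ≤ suppFn squareBody p := by
  obtain h | h := abs_choice (p i)
  · refine (le_of_eq ?_).trans (inner_le_suppFn isCompact_squareBody p
      (axis_mem_squareBody i 1 (by simp)))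
    rw [h, EuclideanSpace.inner_single_right]
    simp
  · refine (le_of_eq ?_).trans (inner_le_suppFn isCompact_squareBody p
      (axis_mem_squareBody i (-1) (by simp)))
    rw [h, EuclideanSpace.inner_single_right]
    simp

theorem sphHaar_le_suppFn_lt :
    sphHaar 2 {θ : Euc 2 | √(3 / 2) ≤ suppFn spiralBody θ} <
      sphHaar 2 {θ : Euc 2 | √(3 / 2) ≤ suppFn squareBody θ} := by
  have hcont : Continuous fun v : Euc 2 => |v 0| := by fun_prop
  calc sphHaar 2 {θ : Euc 2 | √(3 / 2) ≤ suppFn spiralBody θ}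
      ≤ sphHaar 2 {θ : Euc 2 | 1 / 2 ≤ θ 0 ^ 2} := by
        refine ENNReal.div_le_div_right (measure_mono ?_) _
        rintro v ⟨hv, hv1⟩
        refine ⟨?_, hv1⟩
        have h1 := (Real.sqrt_le_sqrt_iff (by positivity)).1
          ((show √(3 / 2) ≤ _ from hv).trans (suppFn_spiralBody_le v))
        have h2 := Euc.norm_sq_two v
        rw [mem_sphere_zero_iff_norm.1 hv1] at h2
        change 1 / 2 ≤ v 0 ^ 2
        linarith
    _ < sphHaar 2 {θ : Euc 2 | 1 / 2 ≤ |θ 0|} := by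
        refine sphHaar_lt_of_isOpen
          (U := {θ : Euc 2 | 1 / 2 < |θ 0|} ∩ {θ | |θ 0| < 7 / 10})
          ((isOpen_lt continuous_const hcont).inter (isOpen_lt hcont continuous_const)) ?_ ?_ ?_
        · intro v hv
          have h : 1 / 2 ≤ v 0 ^ 2 := hv
          change 1 / 2 ≤ |v 0|
          by_contra! hlt
          nlinarith [sq_abs (v 0), abs_nonneg (v 0)]
        · rintro z ⟨h1, h2⟩
          refine ⟨(show 1 / 2 < |circleToEuc z 0| from h1).le, fun h3 => ?_⟩
          have h2' : |circleToEuc z 0| < 7 / 10 := h2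
          have h3' : 1 / 2 ≤ circleToEuc z 0 ^ 2 := h3
          nlinarith [sq_abs (circleToEuc z 0), abs_nonneg (circleToEuc z 0)]
        · have h : circleToEuc (Circle.exp (Real.arccos (3 / 5))) 0 = 3 / 5 := by
            rw [circleToEuc_zero, Circle.coe_exp, Complex.exp_ofReal_mul_I_re,
              Real.cos_arccos (by norm_num) (by norm_num)]
          refine ⟨Circle.exp (Real.arccos (3 / 5)), ?_, ?_⟩
          · change 1 / 2 < |circleToEuc _ 0|
            rw [h]
            norm_num [abs_of_pos]
          · change |circleToEuc _ 0| < 7 / 10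
            rw [h]
            norm_num [abs_of_pos]
    _ = sphHaar 2 {θ : Euc 2 | 1 / 2 ≤ |θ 0 ^ 2 - θ 1 ^ 2|} := by
        refine (sphHaar_congr_sq ((isClosed_le continuous_const hcont).preimage
          isometry_circleToEuc.continuous).measurableSet fun z => ?_).symm
        have h : ((z ^ 2 : Circle) : ℂ).re = (z : ℂ).re ^ 2 - (z : ℂ).im ^ 2 := by
          rw [Circle.coe_pow, sq, Complex.mul_re]
          ring
        simp only [mem_ofPred_eq, circleToEuc_zero, circleToEuc_one, h]
    _ ≤ sphHaar 2 {θ : Euc 2 | √(3 / 2) ≤ suppFn squareBody θ} := by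
        refine ENNReal.div_le_div_right (measure_mono ?_) _
        rintro v ⟨hv, hv1⟩
        refine ⟨?_, hv1⟩
        have h2 := Euc.norm_sq_two v
        rw [mem_sphere_zero_iff_norm.1 hv1] at h2
        have key (i : Fin 2) (hi : 3 / 4 ≤ v i ^ 2) : √(3 / 2) ≤ suppFn squareBody v := by
          refine le_trans ?_ (le_suppFn_squareBody v i)
          rw [← Real.sqrt_sq_eq_abs, ← Real.sqrt_mul zero_le_two]
          exact Real.sqrt_le_sqrt (by linarith)
        obtain h | h := le_abs.1 (show 1 / 2 ≤ |v 0 ^ 2 - v 1 ^ 2| from hv)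
        · exact key 0 (by linarith)
        · exact key 1 (by linarith)

theorem volume_polarBody_squareBody_le : volume (polarBody squareBody) ≤ 2 := by
  have hsub : polarBody squareBody ⊆
      (WithLp.ofLp : Euc 2 → Fin 2 → ℝ) ⁻¹' Icc (fun _ => -(√2)⁻¹) fun _ => (√2)⁻¹ := by
    intro p hp
    have h2 : (0 : ℝ) < √2 := by positivity
    have h (i : Fin 2) (ε : ℝ) (hε : |ε| = 1) : ε * p i ≤ (√2)⁻¹ := by
      have := hp _ (axis_mem_squareBody i ε hε)
      rw [EuclideanSpace.inner_single_right] at this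
      rw [← one_div, le_div_iff₀ h2]
      simp at this
      linarith
    exact ⟨fun i => by linarith [h i (-1) (by simp)], fun i => by linarith [h i 1 (by simp)]⟩
  refine (measure_mono hsub).trans_eq ?_
  rw [(PiLp.volume_preserving_ofLp (Fin 2)).measure_preimage measurableSet_Icc.nullMeasurableSet,
    Real.volume_Icc_pi, Fin.prod_univ_two, ← ENNReal.ofReal_mul' (by simp)]
  have h : ((√2)⁻¹ - -(√2)⁻¹) * ((√2)⁻¹ - -(√2)⁻¹) = 2 := by
    have := Real.mul_self_sqrt (zero_le_two (α := ℝ))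
    field_simp
    linarith
  rw [h, ENNReal.ofReal_ofNat]

theorem lt_volume_polarBody_spiralBody : 2 < volume (polarBody spiralBody) := by
  let f : Euc 2 →ₗ[ℝ] Euc 2 := Matrix.toEuclideanLin (Matrix.diagonal ![√2, 1])
  have hdet : LinearMap.det f = √2 := by
    simp [f, Matrix.toEuclideanLin_eq_toLin_orthonormal]
  have hnorm (p : Euc 2) : ‖f p‖ ^ 2 = 2 * p 0 ^ 2 + p 1 ^ 2 := by
    simp [f, Euc.norm_sq_two, Matrix.toLpLin_apply, mul_pow]
  have hsub : f ⁻¹' closedBall 0 1 ⊆ polarBody spiralBody := by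
    intro p hp v hv
    have h1 : ‖f p‖ ≤ 1 := mem_closedBall_zero_iff.1 hp
    have h2 := inner_sq_le_of_mem_spiralBody p hv
    rw [← hnorm] at h2
    nlinarith [norm_nonneg (f p)]
  have h2 : (0 : ℝ) < √2 := by positivity
  refine lt_of_lt_of_le ?_ (measure_mono hsub)
  rw [Measure.addHaar_preimage_linearMap _ (by rw [hdet]; exact h2.ne'), hdet,
    EuclideanSpace.volume_closedBall_fin_two, abs_of_pos (inv_pos.2 h2), ENNReal.ofReal_one,
    one_pow, one_mul, ← ENNReal.ofReal_mul (inv_pos.2 h2).le, ← ENNReal.ofReal_ofNat,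
    ENNReal.ofReal_lt_ofReal_iff_of_nonneg zero_le_two, ← div_eq_inv_mul, lt_div_iff₀ h2]
  nlinarith [Real.pi_gt_three, Real.sq_sqrt (zero_le_two (α := ℝ))]

/-- There exist origin-symmetric convex bodies `K₀, E₀` in `ℝ²` whose radial
functions are equidistributed, while their support functions are not; in particular the
polar bodies have different areas. -/
theorem stmt_6 : ∃ K₀ E₀ : Set (Euc 2),
    IsConvexBody K₀ ∧ IsConvexBody E₀ ∧ K₀ = -K₀ ∧ E₀ = -E₀ ∧
    (0 : Euc 2) ∈ interior K₀ ∧ (0 : Euc 2) ∈ interior E₀ ∧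
    (∀ t : ℝ, 0 ≤ t →
      sphHaar 2 {θ : Euc 2 | t ≤ radial K₀ θ} =
      sphHaar 2 {θ : Euc 2 | t ≤ radial E₀ θ}) ∧
    (∃ t₀ : ℝ, 0 ≤ t₀ ∧
      sphHaar 2 {θ : Euc 2 | t₀ ≤ suppFn K₀ θ} ≠
      sphHaar 2 {θ : Euc 2 | t₀ ≤ suppFn E₀ θ}) ∧
    volume (polarBody K₀) ≠ volume (polarBody E₀) := by
  have h0 := zero_mem_interior_of_ball_subset ball_subset_spiralBody
  have h1 := zero_mem_interior_of_ball_subset ball_subset_squareBody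
  refine ⟨spiralBody, squareBody, ⟨convex_spiralBody, isCompact_spiralBody, 0, h0⟩,
    ⟨convex_squareBody, isCompact_squareBody, 0, h1⟩, spiralBody_eq_neg, squareBody_eq_neg,
    h0, h1, fun t _ => sphHaar_le_radial_eq t,
    ⟨√(3 / 2), Real.sqrt_nonneg _, sphHaar_le_suppFn_lt.ne⟩,
    (volume_polarBody_squareBody_le.trans_lt lt_volume_polarBody_spiralBody).ne'⟩
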